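/- Fix z ∈ [0, 1/2] and define ψ(w) = h₂((w+z)/2) − (h₂(w) + h₂(z))/2 for w ∈ [z, 1−z], where h₂ is the binary entropy function. Then ψ is monotonically increasing on [z, 1−z]: for all z ≤ w₁ ≤ w₂ ≤ 1−z, ψ(w₁) ≤ ψ(w₂). -/

import Mathlib

/-- Binary entropy function with base-2 logarithm (with `h₂ 0 = h₂ 1 = 0` by the
Lean convention `logb 2 0 = 0`). -/
noncomputable def binEnt (x : ℝ) : ℝ :=
  -(x * Real.logb 2 x) - (1 - x) * Real.logb 2 (1 - x)

/-- Mutual information `I(w,z)` of the binary test channel `[[w,1−w],[z,1−z]]`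
with uniform input. -/
noncomputable def mutI (w z : ℝ) : ℝ :=
  binEnt ((w + z) / 2) - (binEnt w + binEnt z) / 2

/-- Expected total-variation semantic distortion `Λ(w,z)` (fractions with zero
denominator are `0` by the Lean convention `a / 0 = 0`). -/
noncomputable def lamTV (C w z : ℝ) : ℝ :=
  C * (w * z / (w + z) + (1 - w) * (1 - z) / (2 - w - z))

/-- Expected Hamming distortion `Γ(w,z)`. -/
noncomputable def gamH (w z : ℝ) : ℝ := (1 + z - w) / 2

/-- The threshold `a(D_o)`. -/
noncomputable def aThresh (C Do_ : ℝ) : ℝ :=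
  if Do_ ≤ 1 / 2 then 2 * C * Do_ * (1 - Do_) else C / 2

/-- The semantic rate distortion function `R(D_p, D_o)` for the binary case. -/
noncomputable def Rbin (C Dp Do_ : ℝ) : ℝ :=
  sInf {r : ℝ | ∃ w z : ℝ, w ∈ Set.Icc (0 : ℝ) 1 ∧ z ∈ Set.Icc (0 : ℝ) 1 ∧
    lamTV C w z ≤ Dp ∧ gamH w z ≤ Do_ ∧ r = mutI w z}

open Real in
/-- The base-2 binary entropy is the natural one divided by `log 2`. -/
theorem binEnt_eq_binEntropy_div (x : ℝ) : binEnt x = binEntropy x / log 2 := by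
  simp only [binEnt, logb, binEntropy, log_inv]
  ring

open Real in
/-- The gap between the entropy of a midpoint and the mean of the entropies increases as the
right endpoint moves away from the left one. -/
theorem monotoneOn_binEntropy_midpoint_sub {z : ℝ} (hz : 0 ≤ z) :
    MonotoneOn (fun w ↦ binEntropy ((w + z) / 2) - (binEntropy w + binEntropy z) / 2)
      (Set.Icc z 1) := by
  have hderiv : ∀ w ∈ interior (Set.Icc z 1),
      HasDerivAt (fun w ↦ binEntropy ((w + z) / 2) - (binEntropy w + binEntropy z) / 2)
        ((log (1 - (w + z) / 2) - log ((w + z) / 2)) * (1 / 2)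
          - (log (1 - w) - log w) / 2) w := by
    intro w hw
    rw [interior_Icc] at hw
    obtain ⟨hzw, hw1⟩ := hw
    have hmid : HasDerivAt (fun w : ℝ ↦ (w + z) / 2) (1 / 2) w :=
      ((hasDerivAt_id w).add_const z).div_const 2
    have hm : HasDerivAt binEntropy (log (1 - (w + z) / 2) - log ((w + z) / 2)) ((w + z) / 2) :=
      hasDerivAt_binEntropy (by linarith) (by linarith)
    have hw' : HasDerivAt binEntropy (log (1 - w) - log w) w :=
      hasDerivAt_binEntropy (by linarith) (by linarith)
    exact (hm.comp w hmid).sub ((hw'.add_const _).div_const 2)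
  refine monotoneOn_of_deriv_nonneg (convex_Icc z 1) (by fun_prop)
    (fun w hw ↦ (hderiv w hw).differentiableAt.differentiableWithinAt) fun w hw ↦ ?_
  rw [(hderiv w hw).deriv]
  rw [interior_Icc] at hw
  obtain ⟨hzw, hw1⟩ := hw
  have hle : log ((w + z) / 2) ≤ log w := log_le_log (by linarith) (by linarith)
  have hle' : log (1 - w) ≤ log (1 - (w + z) / 2) := log_le_log (by linarith) (by linarith)
  linarith

/-- For fixed `z ∈ [0, 1/2]`, the map `w ↦ I(w,z)` is monotonically increasing
on `[z, 1−z]`. -/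
theorem mutual_information_increasing_in_w
    (z : ℝ) (hz : z ∈ Set.Icc (0 : ℝ) (1 / 2))
    (w₁ w₂ : ℝ) (h₁ : z ≤ w₁) (h₁₂ : w₁ ≤ w₂) (h₂ : w₂ ≤ 1 - z) :
    mutI w₁ z ≤ mutI w₂ z := by
  have hmono := monotoneOn_binEntropy_midpoint_sub hz.1
    ⟨h₁, by linarith [hz.1]⟩ ⟨h₁.trans h₁₂, by linarith [hz.1]⟩ h₁₂
  have hscale : ∀ w, mutI w z = (Real.binEntropy ((w + z) / 2)
      - (Real.binEntropy w + Real.binEntropy z) / 2) / Real.log 2 := by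
    intro w
    simp only [mutI, binEnt_eq_binEntropy_div]
    ring
  rw [hscale, hscale]
  exact div_le_div_of_nonneg_right hmono (Real.log_nonneg one_le_two)
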